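/- arXiv:1706.02343 — 2 statements merged into one kernel-verified Lean document; each statement's English description precedes it below -/
import Mathlib

section
/- Let I ⊆ ℝ be a nondegenerate interval and let φ : I → ℝ. Suppose that for every nondegenerate interval J ⊆ ℝ and every function f that is operator convex on J with f(J) ⊆ I, the composite φ∘f is strongly operator convex on J. Then φ is both operator monotone and strongly operator convex on I. -/
open Matrix Set
open scoped ComplexOrder

/-- `f` is operator monotone on `I ⊆ ℝ`: for every `n ≥ 1` and all `n×n` Hermitian complex
matrices `A, B` with spectra (eigenvalues) contained in `I`, `A ≤ B` in the Loewner order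
implies `f(A) ≤ f(B)`, where `f(A)` is given by the functional calculus. -/
def OperatorMonotoneOn (f : ℝ → ℝ) (I : Set ℝ) : Prop :=
  ∀ (n : ℕ), 0 < n → ∀ (A B : Matrix (Fin n) (Fin n) ℂ)
    (hA : A.IsHermitian) (hB : B.IsHermitian),
    (∀ i, hA.eigenvalues i ∈ I) → (∀ i, hB.eigenvalues i ∈ I) →
    (B - A).PosSemidef → (hB.cfc f - hA.cfc f).PosSemidef

/-- `f` is operator convex on `I ⊆ ℝ`: for every `n ≥ 1`, every `t ∈ [0,1]` and all `n×n`
Hermitian complex matrices `A, B` with spectra contained in `I`,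
`f(tA + (1−t)B) ≤ t·f(A) + (1−t)·f(B)` in the Loewner order. -/
def OperatorConvexOn (f : ℝ → ℝ) (I : Set ℝ) : Prop :=
  ∀ (n : ℕ), 0 < n → ∀ t : ℝ, t ∈ Set.Icc (0 : ℝ) 1 →
  ∀ (A B : Matrix (Fin n) (Fin n) ℂ) (hA : A.IsHermitian) (hB : B.IsHermitian)
    (hAB : ((t : ℂ) • A + ((1 : ℂ) - (t : ℂ)) • B).IsHermitian),
    (∀ i, hA.eigenvalues i ∈ I) → (∀ i, hB.eigenvalues i ∈ I) →
    ((t : ℂ) • hA.cfc f + ((1 : ℂ) - (t : ℂ)) • hB.cfc f - hAB.cfc f).PosSemidef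

/-- `f` is strongly operator convex on `I ⊆ ℝ`: there is `x₀ ∈ I` such that for every `n ≥ 1`,
every `n×n` orthogonal projection `P` and every `n×n` Hermitian matrix `H` with spectrum
contained in `I`, `P·f(PHP + x₀(1−P))·P ≤ f(H)` in the Loewner order. -/
def StronglyOperatorConvexOn (f : ℝ → ℝ) (I : Set ℝ) : Prop :=
  ∃ x₀ ∈ I, ∀ (n : ℕ), 0 < n → ∀ (P H : Matrix (Fin n) (Fin n) ℂ),
    P.IsHermitian → P * P = P →
    ∀ (hH : H.IsHermitian)
      (hK : (P * H * P + (x₀ : ℂ) • ((1 : Matrix (Fin n) (Fin n) ℂ) - P)).IsHermitian),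
    (∀ i, hH.eigenvalues i ∈ I) →
    (hH.cfc f - P * hK.cfc f * P).PosSemidef

lemma spectrum_subset_iff_eigenvalues {ι : Type*} [Fintype ι] [DecidableEq ι]
    {A : Matrix ι ι ℂ} (hA : A.IsHermitian) {I : Set ℝ} :
    spectrum ℝ A ⊆ I ↔ ∀ i, hA.eigenvalues i ∈ I := by
  rw [hA.spectrum_real_eq_range_eigenvalues, Set.range_subset_iff]

lemma continuousOn_spectrum_of_isHermitian {ι : Type*} [Fintype ι] [DecidableEq ι]
    {A : Matrix ι ι ℂ} (hA : A.IsHermitian) (f : ℝ → ℝ) : ContinuousOn f (spectrum ℝ A) := by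
  rw [hA.spectrum_real_eq_range_eigenvalues]
  exact (Set.finite_range _).continuousOn f

lemma isHermitian_cfc {ι : Type*} [Fintype ι] [DecidableEq ι] (f : ℝ → ℝ) (A : Matrix ι ι ℂ) :
    (cfc f A).IsHermitian :=
  (cfc_predicate f A : IsSelfAdjoint _)

/-- The functional calculus respects intertwiners between Hermitian matrices. -/
lemma cfc_mul_eq_mul_cfc_of_intertwine {ι κ : Type*} [Fintype ι] [DecidableEq ι]
    [Fintype κ] [DecidableEq κ] {X : Matrix ι ι ℂ} {Y : Matrix κ κ ℂ} (hX : X.IsHermitian)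
    (hY : Y.IsHermitian) {V : Matrix ι κ ℂ} (h : X * V = V * Y) (f : ℝ → ℝ) :
    cfc f X * V = V * cfc f Y := by
  classical
  have hfin : (spectrum ℝ X ∪ spectrum ℝ Y).Finite := by
    rw [hX.spectrum_real_eq_range_eigenvalues, hY.spectrum_real_eq_range_eigenvalues]
    exact (Set.finite_range _).union (Set.finite_range _)
  set q := Lagrange.interpolate hfin.toFinset id f with hq
  have hqe : ∀ x ∈ spectrum ℝ X ∪ spectrum ℝ Y, f x = q.eval x := fun x hx =>
    (Lagrange.eval_interpolate_at_node (v := id) f (Set.injOn_id _)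
      (hfin.mem_toFinset.mpr hx)).symm
  have key : ∀ p : Polynomial ℝ, Polynomial.aeval X p * V = V * Polynomial.aeval Y p := by
    intro p
    induction p using Polynomial.induction_on' with
    | add p r hp hr => simp [Matrix.add_mul, Matrix.mul_add, hp, hr]
    | monomial n a =>
      have hpow : X ^ n * V = V * Y ^ n := by
        induction n with
        | zero => simp
        | succ n ih => rw [pow_succ, pow_succ, Matrix.mul_assoc, h, ← Matrix.mul_assoc, ih,
            Matrix.mul_assoc]
      simp [Polynomial.aeval_monomial, Algebra.algebraMap_eq_smul_one, hpow]
  rw [cfc_congr (g := q.eval) (fun x hx => hqe x (Or.inl hx)),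
    cfc_congr (a := Y) (g := q.eval) (fun x hx => hqe x (Or.inr hx)),
    cfc_polynomial q X hX.isSelfAdjoint, cfc_polynomial q Y hY.isSelfAdjoint, key]

/-- A strongly operator convex function satisfies Jensen's operator inequality for isometries. -/
lemma StronglyOperatorConvexOn.jensen {ψ : ℝ → ℝ} {J : Set ℝ} (h : StronglyOperatorConvexOn ψ J)
    {ι κ : Type*} [Fintype ι] [DecidableEq ι] [Nonempty ι] [Fintype κ] [DecidableEq κ]
    {H : Matrix ι ι ℂ} (hH : H.IsHermitian) (hs : spectrum ℝ H ⊆ J) {V : Matrix ι κ ℂ}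
    (hV : Vᴴ * V = 1) : (Vᴴ * cfc ψ H * V - cfc ψ (Vᴴ * H * V)).PosSemidef := by
  obtain ⟨x₀, hx₀, h⟩ := h
  have fin : ∀ (n : ℕ), 0 < n → ∀ {H : Matrix (Fin n) (Fin n) ℂ}, H.IsHermitian →
      spectrum ℝ H ⊆ J → ∀ {V : Matrix (Fin n) κ ℂ}, Vᴴ * V = 1 →
      (Vᴴ * cfc ψ H * V - cfc ψ (Vᴴ * H * V)).PosSemidef := by
    intro n hn H hH hs V hV
    have hP : (V * Vᴴ).IsHermitian := isHermitian_mul_conjTranspose_self V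
    have hPP : V * Vᴴ * (V * Vᴴ) = V * Vᴴ := by
      rw [Matrix.mul_assoc, ← Matrix.mul_assoc Vᴴ, hV, Matrix.one_mul]
    have hc : (Vᴴ * H * V).IsHermitian := isHermitian_conjTranspose_mul_mul V hH
    have hK : (V * Vᴴ * H * (V * Vᴴ) + (x₀ : ℂ) • (1 - V * Vᴴ)).IsHermitian := by
      refine IsHermitian.add ?_ ?_
      · simpa [hP.eq] using isHermitian_conjTranspose_mul_mul (V * Vᴴ) hH
      · refine (isHermitian_one.sub hP).smul ?_
        simp [IsSelfAdjoint]
    have hKV : (V * Vᴴ * H * (V * Vᴴ) + (x₀ : ℂ) • (1 - V * Vᴴ)) * V = V * (Vᴴ * H * V) := by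
      have hPV : V * Vᴴ * V = V := by rw [Matrix.mul_assoc, hV, Matrix.mul_one]
      rw [Matrix.add_mul, Matrix.smul_mul, Matrix.sub_mul, hPV, Matrix.one_mul, sub_self,
        smul_zero, add_zero, Matrix.mul_assoc _ (V * Vᴴ) V, hPV]
      simp only [Matrix.mul_assoc]
    have hi := cfc_mul_eq_mul_cfc_of_intertwine hK hc hKV ψ
    have := (h n hn (V * Vᴴ) H hP hPP hH hK
      ((spectrum_subset_iff_eigenvalues hH).mp hs)).conjTranspose_mul_mul_same V
    rw [← hH.cfc_eq, ← hK.cfc_eq] at this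
    convert this using 1
    rw [Matrix.mul_sub, Matrix.sub_mul]
    congr 1
    calc cfc ψ (Vᴴ * H * V) = (Vᴴ * V) * (Vᴴ * V * cfc ψ (Vᴴ * H * V)) := by simp [hV]
      _ = Vᴴ * (V * Vᴴ * (V * cfc ψ (Vᴴ * H * V))) := by simp only [Matrix.mul_assoc]
      _ = Vᴴ * (V * Vᴴ * (cfc ψ (V * Vᴴ * H * (V * Vᴴ) + (x₀ : ℂ) • (1 - V * Vᴴ)) * V)) := by
        rw [hi]
      _ = Vᴴ * (V * Vᴴ * (cfc ψ (V * Vᴴ * H * (V * Vᴴ) + (x₀ : ℂ) • (1 - V * Vᴴ)) *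
          (V * (Vᴴ * V)))) := by rw [hV, Matrix.mul_one]
      _ = _ := by simp only [Matrix.mul_assoc]
  let e := Fintype.equivFin ι
  let U : Matrix (Fin (Fintype.card ι)) ι ℂ := (1 : Matrix ι ι ℂ).submatrix e.symm id
  have hUU : Uᴴ * U = 1 := by
    simp only [U, conjTranspose_submatrix, conjTranspose_one]
    rw [Matrix.submatrix_mul_equiv, Matrix.one_mul, submatrix_id_id]
  have hUU' : U * Uᴴ = 1 := by
    simp only [U, conjTranspose_submatrix, conjTranspose_one]
    rw [← Matrix.submatrix_mul _ _ _ _ _ Function.bijective_id, Matrix.one_mul]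
    exact submatrix_one_equiv _
  have hH' : (U * H * Uᴴ).IsHermitian := isHermitian_mul_mul_conjTranspose U hH
  have hint : U * H * Uᴴ * U = U * H := by rw [Matrix.mul_assoc _ Uᴴ, hUU, Matrix.mul_one]
  have hspec : spectrum ℝ (U * H * Uᴴ) ⊆ J := by
    let φ : Matrix ι ι ℂ →ₐ[ℝ] Matrix (Fin (Fintype.card ι)) (Fin (Fintype.card ι)) ℂ :=
      AlgHom.ofLinearMap
        { toFun := fun M => U * M * Uᴴ
          map_add' := fun M N => by simp [Matrix.mul_add, Matrix.add_mul]
          map_smul' := fun r M => by simp }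
        (by simp [hUU'])
        (fun M N => by
          change U * (M * N) * Uᴴ = U * M * Uᴴ * (U * N * Uᴴ)
          calc U * (M * N) * Uᴴ = U * M * (1 : Matrix ι ι ℂ) * N * Uᴴ := by simp [Matrix.mul_assoc]
            _ = _ := by rw [← hUU]; simp only [Matrix.mul_assoc])
    exact (AlgHom.spectrum_apply_subset φ H).trans hs
  have hi := cfc_mul_eq_mul_cfc_of_intertwine hH' hH hint ψ
  have := fin _ Fintype.card_pos hH' hspec (V := U * V)
    (by rw [conjTranspose_mul, Matrix.mul_assoc, ← Matrix.mul_assoc Uᴴ, hUU, Matrix.one_mul, hV])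
  convert this using 2
  · rw [conjTranspose_mul, Matrix.mul_assoc _ _ (U * V), ← Matrix.mul_assoc _ U V, hi]
    calc Vᴴ * cfc ψ H * V = Vᴴ * (1 : Matrix ι ι ℂ) * cfc ψ H * V := by simp
      _ = _ := by rw [← hUU]; simp only [Matrix.mul_assoc]
  · congr 1
    rw [conjTranspose_mul]
    calc Vᴴ * H * V = Vᴴ * (1 : Matrix ι ι ℂ) * H * (1 : Matrix ι ι ℂ) * V := by simp
      _ = _ := by rw [← hUU]; simp only [Matrix.mul_assoc]

lemma cfc_diagonal_ofReal {ι : Type*} [Fintype ι] [DecidableEq ι] (d : ι → ℝ) (f : ℝ → ℝ) :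
    cfc f (diagonal (fun i => (d i : ℂ))) = diagonal (fun i => (f (d i) : ℂ)) := by
  have hD : (diagonal (fun i => (d i : ℂ))).IsHermitian :=
    isHermitian_diagonal_of_self_adjoint _ (by ext i; simp)
  ext i j
  have hY : (algebraMap ℝ (Matrix Unit Unit ℂ) (d j)).IsHermitian :=
    (cfc_predicate_algebraMap (d j) : IsSelfAdjoint _)
  have := cfc_mul_eq_mul_cfc_of_intertwine hD hY (V := of fun k _ => if k = j then 1 else 0)
    (by
      ext k l
      rw [diagonal_mul]
      by_cases hk : k = j <;> simp [Matrix.mul_apply, algebraMap_matrix_apply, hk]) f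
  rw [cfc_algebraMap] at this
  have := congrFun (congrFun this i) ()
  simp only [Matrix.mul_apply, of_apply, mul_ite, mul_one, mul_zero, Finset.sum_ite_eq',
    Finset.mem_univ, if_true] at this
  rw [this]
  by_cases hij : i = j <;> simp [hij, algebraMap_matrix_apply]

lemma StronglyOperatorConvexOn.convexOn {ψ : ℝ → ℝ} {J : Set ℝ}
    (h : StronglyOperatorConvexOn ψ J) (hJ : Convex ℝ J) : ConvexOn ℝ J ψ := by
  refine ⟨hJ, fun x hx y hy a b ha hb hab => ?_⟩
  have hH : (diagonal (fun i => ((![x, y] i : ℝ) : ℂ))).IsHermitian :=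
    isHermitian_diagonal_of_self_adjoint _ (by ext i; simp)
  have hs : spectrum ℝ (diagonal (fun i => ((![x, y] i : ℝ) : ℂ))) ⊆ J := by
    intro r hr
    have := spectrum.algebraMap_mem ℂ hr
    rw [spectrum_diagonal] at this
    obtain ⟨i, hi⟩ := this
    have : ![x, y] i = r := Complex.ofReal_injective hi
    rw [← this]
    fin_cases i <;> simp [hx, hy]
  have hsa : (√a : ℂ) * √a = a := by exact_mod_cast Real.mul_self_sqrt ha
  have hsb : (√b : ℂ) * √b = b := by exact_mod_cast Real.mul_self_sqrt hb
  have hab' : (a : ℂ) + b = 1 := by exact_mod_cast hab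
  have hc : ∀ u v : ℝ, (!![(√a : ℂ); (√b : ℂ)])ᴴ *
      diagonal (fun i => ((![u, v] i : ℝ) : ℂ)) * !![(√a : ℂ); (√b : ℂ)] =
      algebraMap ℝ (Matrix (Fin 1) (Fin 1) ℂ) (a * u + b * v) := by
    intro u v
    ext i j
    fin_cases i; fin_cases j
    simp [Matrix.mul_apply, Fin.sum_univ_two, algebraMap_matrix_apply, Matrix.diagonal]
    linear_combination (u : ℂ) * hsa + (v : ℂ) * hsb
  have := h.jensen hH hs (V := !![(√a : ℂ); (√b : ℂ)]) (by
    ext i j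
    fin_cases i; fin_cases j
    simp [Matrix.mul_apply, Fin.sum_univ_two]
    linear_combination hsa + hsb + hab')
  have hd : (fun i => ((ψ (![x, y] i) : ℝ) : ℂ)) = fun i => ((![ψ x, ψ y] i : ℝ) : ℂ) := by
    ext i; fin_cases i <;> simp
  rw [cfc_diagonal_ofReal, hd, hc, hc, cfc_algebraMap, ← map_sub] at this
  have := this.diag_nonneg (i := 0)
  simp only [algebraMap_matrix_apply, if_true, Complex.coe_algebraMap] at this
  have : 0 ≤ a * ψ x + b * ψ y - ψ (a * x + b * y) := by exact_mod_cast this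
  simpa using this

lemma operatorConvexOn_id (J : Set ℝ) : OperatorConvexOn id J := by
  intro n _ t _ A B hA hB hAB _ _
  rw [← hA.cfc_eq, ← hB.cfc_eq, ← hAB.cfc_eq, cfc_id ℝ A hA.isSelfAdjoint,
    cfc_id ℝ B hB.isSelfAdjoint, cfc_id ℝ _ hAB.isSelfAdjoint, sub_self]
  exact .zero

lemma operatorConvexOn_const_add_sq (c : ℝ) (J : Set ℝ) :
    OperatorConvexOn (fun x => c + x ^ 2) J := by
  intro n _ t ht A B hA hB hAB _ _
  have key : ∀ {X : Matrix (Fin n) (Fin n) ℂ}, X.IsHermitian →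
      cfc (fun x : ℝ => c + x ^ 2) X = algebraMap ℝ _ c + X * X := by
    intro X hX
    rw [cfc_const_add c (fun x => x ^ 2) X (by fun_prop) hX.isSelfAdjoint,
      cfc_pow_id X 2 hX.isSelfAdjoint, sq]
  rw [← hA.cfc_eq, ← hB.cfc_eq, ← hAB.cfc_eq, key hA, key hB, key hAB]
  have hp := (posSemidef_conjTranspose_mul_self (A - B)).smul
    (mul_nonneg ht.1 (sub_nonneg.2 ht.2))
  rw [(hA.sub hB).eq] at hp
  convert hp using 1
  have : (t * (1 - t)) • ((A - B) * (A - B)) =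
    ((t : ℂ) * (1 - (t : ℂ))) • ((A - B) * (A - B)) := by
    ext i j; simp [Matrix.smul_apply]
  rw [this]
  simp only [Matrix.add_mul, Matrix.mul_add, Matrix.sub_mul, Matrix.mul_sub, Matrix.smul_mul,
    Matrix.mul_smul]
  module

lemma posDef_of_spectrum_subset_Ioi {ι : Type*} [Fintype ι] [DecidableEq ι]
    {A : Matrix ι ι ℂ} (hA : A.IsHermitian) (h : spectrum ℝ A ⊆ Ioi 0) : A.PosDef :=
  hA.posDef_iff_eigenvalues_pos.mpr ((spectrum_subset_iff_eigenvalues hA).mp h)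

lemma cfc_inv_sub_eq {ι : Type*} [Fintype ι] [DecidableEq ι] {A Y : Matrix ι ι ℂ}
    (hA : A.IsHermitian) (s : ℝ) (hs : s ∉ spectrum ℝ A) (hY : Y * (A - algebraMap ℝ _ s) = 1) :
    cfc (fun x => (x - s)⁻¹) A = Y := by
  have h1 : cfc (fun x => x - s) A = A - algebraMap ℝ _ s := by
    rw [cfc_sub (fun x => x) (fun _ => s) A (by fun_prop) (by fun_prop), cfc_id' ℝ A hA.isSelfAdjoint,
      cfc_const s A hA.isSelfAdjoint]
  have h2 : cfc (fun x => x - s) A * cfc (fun x => (x - s)⁻¹) A = 1 := by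
    rw [← cfc_mul (fun x => x - s) (fun x => (x - s)⁻¹) A (by fun_prop)
      (continuousOn_spectrum_of_isHermitian hA _), ← cfc_one ℝ A hA.isSelfAdjoint]
    refine cfc_congr fun x hx => ?_
    have : x - s ≠ 0 := fun h => hs (by rwa [← sub_eq_zero.mp h])
    simp [this]
  rw [h1] at h2
  calc _ = Y * (A - algebraMap ℝ _ s) * cfc (fun x => (x - s)⁻¹) A := by rw [hY, Matrix.one_mul]
    _ = Y := by rw [Matrix.mul_assoc, h2, Matrix.mul_one]

lemma operatorConvexOn_const_add_inv (s : ℝ) : OperatorConvexOn (fun x => s + x⁻¹) (Ioi 0) := by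
  intro n _ t ht A B hA hB hAB hsA hsB
  have hA' := hA.posDef_iff_eigenvalues_pos.mpr hsA
  have hB' := hB.posDef_iff_eigenvalues_pos.mpr hsB
  have hM : ((t : ℂ) • A + ((1 : ℂ) - (t : ℂ)) • B).PosDef := by
    rcases eq_or_lt_of_le ht.1 with h0 | h0
    · simpa [← h0] using hB'
    · have h0' : (0 : ℂ) < t := by exact_mod_cast h0
      have h1' : (0 : ℂ) ≤ 1 - t := by
        have := sub_nonneg.2 ht.2
        exact_mod_cast this
      exact (hA'.smul h0').add_posSemidef (hB'.posSemidef.smul h1')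
  have key : ∀ {X : Matrix (Fin n) (Fin n) ℂ}, X.PosDef →
      cfc (fun x : ℝ => s + x⁻¹) X = algebraMap ℝ _ s + X⁻¹ := by
    intro X hX
    have h0 : (0 : ℝ) ∉ spectrum ℝ X := by
      rw [spectrum.zero_notMem_iff]; exact hX.isUnit
    rw [cfc_const_add s (fun x => x⁻¹) X (continuousOn_spectrum_of_isHermitian hX.1 _)
      hX.1.isSelfAdjoint]
    have := cfc_inv_sub_eq (Y := X⁻¹) hX.1 0 h0
      (by rw [map_zero, sub_zero]; exact nonsing_inv_mul X ((isUnit_iff_isUnit_det X).mp hX.isUnit))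
    simp only [sub_zero] at this
    rw [this]
  have block : ∀ {X : Matrix (Fin n) (Fin n) ℂ}, X.PosDef →
      (fromBlocks X⁻¹ 1 1 X).PosSemidef := by
    intro X hX
    have := hX.isUnit.invertible
    have := (hX.fromBlocks₂₂ X⁻¹ 1).mpr (by simpa using PosSemidef.zero)
    simpa using this
  have h1' : (0 : ℂ) ≤ 1 - t := by
    have := sub_nonneg.2 ht.2
    exact_mod_cast this
  have h0' : (0 : ℂ) ≤ t := by exact_mod_cast ht.1
  have hsum := ((block hA').smul h0').add ((block hB').smul h1')
  rw [fromBlocks_smul, fromBlocks_smul, fromBlocks_add] at hsum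
  have h11 : (t : ℂ) • (1 : Matrix (Fin n) (Fin n) ℂ) + (1 - (t : ℂ)) • 1 = 1 := by module
  rw [h11] at hsum
  have := hM.isUnit.invertible
  have hfin := (hM.fromBlocks₂₂ ((t : ℂ) • A⁻¹ + ((1 : ℂ) - (t : ℂ)) • B⁻¹) 1).mp
    (by simpa using hsum)
  rw [← hA.cfc_eq, ← hB.cfc_eq, ← hAB.cfc_eq, key hA', key hB', key hM]
  rw [conjTranspose_one, Matrix.mul_one, Matrix.one_mul] at hfin
  have e : (t : ℂ) • (algebraMap ℝ (Matrix (Fin n) (Fin n) ℂ) s + A⁻¹) +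
      ((1 : ℂ) - (t : ℂ)) • (algebraMap ℝ (Matrix (Fin n) (Fin n) ℂ) s + B⁻¹) -
      (algebraMap ℝ (Matrix (Fin n) (Fin n) ℂ) s + ((t : ℂ) • A + ((1 : ℂ) - (t : ℂ)) • B)⁻¹) =
      (t : ℂ) • A⁻¹ + ((1 : ℂ) - (t : ℂ)) • B⁻¹ -
        ((t : ℂ) • A + ((1 : ℂ) - (t : ℂ)) • B)⁻¹ := by
    module
  rw [e]
  exact hfin

open scoped Matrix.Norms.L2Operator in
lemma eventually_spectrum_subset_and_tendsto_cfc {ι : Type*} [Fintype ι] [DecidableEq ι]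
    {K : ℝ → Matrix ι ι ℂ} (hK : ∀ x, (K x).IsHermitian) (hc : Continuous K) (x₀ : ℝ) {U : Set ℝ}
    (hU : IsOpen U) (hs : spectrum ℝ (K x₀) ⊆ U) {f : ℝ → ℝ} (hf : ContinuousOn f U) :
    (∀ᶠ x in nhds x₀, spectrum ℝ (K x) ⊆ U) ∧
      Filter.Tendsto (fun x => cfc f (K x)) (nhds x₀) (nhds (cfc f (K x₀))) := by
  obtain ⟨S, ⟨hS₁, hS₂⟩, hS₃⟩ := (spectrum.isCompact (𝕜 := ℝ)
    (K x₀)).nhdsSet_basis_isCompact.mem_iff.mp (hU.mem_nhdsSet.mpr hs)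
  have hev : ∀ᶠ x in nhds x₀, spectrum ℝ (K x) ⊆ S :=
    hc.continuousAt.eventually (((upperHemicontinuous_spectrum ℝ
      (Matrix ι ι ℂ)).upperHemicontinuousAt (K x₀) _ hS₁).mono fun _ => subset_of_mem_nhdsSet)
  refine ⟨hev.mono fun x hx => hx.trans hS₃, ?_⟩
  exact Filter.Tendsto.cfc hS₂ f hc.continuousAt hev
    (.of_forall fun x => (hK x).isSelfAdjoint) hev.self_of_nhds (hK x₀).isSelfAdjoint
    (hf.mono hS₃)

lemma posSemidef_of_tendsto {ι α : Type*} [Fintype ι] {l : Filter α} [l.NeBot]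
    {M : α → Matrix ι ι ℂ} {M₀ : Matrix ι ι ℂ} (hM : Filter.Tendsto M l (nhds M₀))
    (h : ∀ᶠ x in l, (M x).PosSemidef) : M₀.PosSemidef := by
  have hcl : IsClosed {N : Matrix ι ι ℂ | N.IsHermitian ∧ ∀ x : ι → ℂ, 0 ≤ star x ⬝ᵥ (N *ᵥ x)} := by
    simp only [Set.ofPred_and, Set.ofPred_forall]
    exact (isClosed_eq (by fun_prop) (by fun_prop)).inter
      (isClosed_iInter fun x => isClosed_le (by fun_prop) (by fun_prop))
  have := hcl.mem_of_tendsto hM (h.mono fun x hx => ⟨hx.1, fun y => hx.dotProduct_mulVec_nonneg y⟩)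
  exact .of_dotProduct_mulVec_nonneg this.1 this.2

lemma exists_isHermitian_mul_self_eq {ι : Type*} [Fintype ι] [DecidableEq ι] {M : Matrix ι ι ℂ}
    (hM : M.PosSemidef) : ∃ E : Matrix ι ι ℂ, E.IsHermitian ∧ E * E = M := by
  refine ⟨cfc Real.sqrt M, isHermitian_cfc _ _, ?_⟩
  rw [← cfc_mul Real.sqrt Real.sqrt M (by fun_prop) (by fun_prop)]
  conv_rhs => rw [← cfc_id ℝ M hM.1.isSelfAdjoint]
  refine cfc_congr fun x hx => Real.mul_self_sqrt ?_
  exact (spectrum_subset_iff_eigenvalues hM.1 (I := Ici 0)).mpr hM.eigenvalues_nonneg hx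


lemma cfc_cfc_inv_sub {ι : Type*} [Fintype ι] [DecidableEq ι] {A : Matrix ι ι ℂ}
    (hA : A.IsHermitian) (φ : ℝ → ℝ) (s : ℝ) :
    cfc (φ ∘ fun x => s + x⁻¹) (cfc (fun x => (x - s)⁻¹) A) = cfc φ A := by
  have hfin := Set.finite_range hA.eigenvalues
  rw [← hA.spectrum_real_eq_range_eigenvalues] at hfin
  rw [← cfc_comp' (φ ∘ fun x => s + x⁻¹) (fun x => (x - s)⁻¹) A
    ((hfin.image _).continuousOn _) (hfin.continuousOn _) hA.isSelfAdjoint]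
  congr 1
  ext x
  simp

lemma posDef_sub_algebraMap {ι : Type*} [Fintype ι] [DecidableEq ι] {A : Matrix ι ι ℂ}
    (hA : A.IsHermitian) {s : ℝ} (hs : spectrum ℝ A ⊆ Ioi s) :
    (A - algebraMap ℝ _ s).PosDef := by
  refine posDef_of_spectrum_subset_Ioi
    (hA.sub (cfc_predicate_algebraMap s : IsSelfAdjoint _)) ?_
  rw [← spectrum.sub_singleton_eq]
  rintro _ ⟨x, hx, y, rfl, rfl⟩
  exact mem_Ioi.mpr (sub_pos.mpr (mem_Ioi.mp (hs hx)))

lemma spectrum_subset_Ioi_of_posDef {ι : Type*} [Fintype ι] [DecidableEq ι] {A : Matrix ι ι ℂ}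
    {s : ℝ} (h : (A - algebraMap ℝ _ s).PosDef) : spectrum ℝ A ⊆ Ioi s := by
  intro x hx
  have : x - s ∈ spectrum ℝ (A - algebraMap ℝ _ s) := by
    rw [← spectrum.sub_singleton_eq]
    exact ⟨x, hx, s, rfl, rfl⟩
  exact mem_Ioi.mpr (sub_pos.mp (mem_Ioi.mp ((spectrum_subset_iff_eigenvalues h.1).mpr
    (fun i => mem_Ioi.mpr (h.1.posDef_iff_eigenvalues_pos.mp h i)) this)))

/-- The interior case of operator monotonicity. -/
lemma posSemidef_cfc_sub_cfc_of_inv {ι : Type*} [Fintype ι] [DecidableEq ι] {φ : ℝ → ℝ}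
    {s s₀ m : ℝ} (hs : s₀ < s) (hsm : s < m) (hφ : ContinuousOn φ (Ioo s₀ m))
    (h : StronglyOperatorConvexOn (φ ∘ fun x => s + x⁻¹) (Ioi (m - s)⁻¹))
    {A B : Matrix ι ι ℂ} (hA : A.IsHermitian) (hB : B.IsHermitian)
    (hsA : spectrum ℝ A ⊆ Ioi s) (hsB : spectrum ℝ B ⊆ Ioo s₀ m)
    (hAB : (B - A).PosSemidef) : (cfc φ B - cfc φ A).PosSemidef := by
  cases isEmpty_or_nonempty ι
  · rw [Subsingleton.elim (cfc φ B - cfc φ A) 0]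
    exact .zero
  obtain ⟨E, hE, hEE⟩ := exists_isHermitian_mul_self_eq hAB
  let K : ℝ → Matrix (ι ⊕ ι) (ι ⊕ ι) ℂ := fun θ =>
    fromBlocks B (θ • E) (θ • E) (algebraMap ℝ _ (s + θ ^ 2))
  let V : Matrix (ι ⊕ ι) ι ℂ := fromRows 1 0
  have hVt : Vᴴ = fromCols 1 0 := by simp [V, conjTranspose_fromRows_eq_fromCols_conjTranspose]
  have hV : Vᴴ * V = 1 := by
    simp [hVt, V, fromCols_mul_fromRows]
  have hK : ∀ θ, (K θ).IsHermitian := by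
    intro θ
    have hθE : (θ • E).IsHermitian := hE.smul (by simp [IsSelfAdjoint])
    exact hB.fromBlocks hθE.eq (cfc_predicate_algebraMap _ : IsSelfAdjoint _)
  have hKc : Continuous K := by
    refine Continuous.matrix_fromBlocks (by fun_prop) (by fun_prop) (by fun_prop) ?_
    simp only [Algebra.algebraMap_eq_smul_one]
    fun_prop
  have hK0 : K 0 * V = V * B := by
    simp [K, V, fromBlocks_mul_fromRows, fromRows_mul]
  have hsK : spectrum ℝ (K 0) ⊆ Ioo s₀ m := by
    intro r hr
    by_contra hcon
    have h1 : r ∉ spectrum ℝ B := fun h' => hcon (hsB h')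
    have h2 : r - s ≠ 0 := by
      intro h'
      rw [sub_eq_zero.mp h'] at hcon
      exact hcon ⟨hs, hsm⟩
    rw [spectrum.notMem_iff] at h1
    refine hr (spectrum.mem_resolventSet_iff.mpr ?_)
    have : algebraMap ℝ (Matrix (ι ⊕ ι) (ι ⊕ ι) ℂ) r - K 0 =
        fromBlocks (algebraMap ℝ _ r - B) 0 0 (algebraMap ℝ _ (r - s)) := by
      simp [K, Algebra.algebraMap_eq_smul_one, ← fromBlocks_one, fromBlocks_smul, sub_eq_add_neg,
        fromBlocks_neg, fromBlocks_add, add_smul]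
    rw [this]
    exact isUnit_fromBlocks_zero₂₁.mpr ⟨h1, (IsUnit.mk0 _ h2).map _⟩
  obtain ⟨hev, hlim⟩ := eventually_spectrum_subset_and_tendsto_cfc hK hKc 0 isOpen_Ioo hsK hφ
  have hgoal : Vᴴ * cfc φ (K 0) * V - cfc φ A = cfc φ B - cfc φ A := by
    rw [Matrix.mul_assoc, cfc_mul_eq_mul_cfc_of_intertwine (hK 0) hB hK0, ← Matrix.mul_assoc, hV,
      Matrix.one_mul]
  rw [← hgoal]
  refine posSemidef_of_tendsto (l := nhdsWithin 0 (Ioi 0))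
    (M := fun θ => Vᴴ * cfc φ (K θ) * V - cfc φ A) ?_ ?_
  · have hcont : Continuous fun N : Matrix (ι ⊕ ι) (ι ⊕ ι) ℂ => Vᴴ * N * V - cfc φ A := by fun_prop
    exact (hcont.tendsto _).comp (hlim.mono_left nhdsWithin_le_nhds)
  filter_upwards [nhdsWithin_le_nhds hev, self_mem_nhdsWithin] with θ hθs hθ
  have hθ0 : θ ≠ 0 := ne_of_gt hθ
  have hX := posDef_sub_algebraMap hA hsA
  set X := A - algebraMap ℝ _ s with hXdef
  have hXi : X⁻¹ * X = 1 := nonsing_inv_mul X ((isUnit_iff_isUnit_det X).mp hX.isUnit)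
  have hBX : B - algebraMap ℝ _ s = X + E * E := by rw [hEE, hXdef]; abel
  have hKs : K θ - algebraMap ℝ _ s = fromBlocks (X + E * E) (θ • E) (θ • E) (θ ^ 2 • 1) := by
    rw [← hBX]
    simp [K, Algebra.algebraMap_eq_smul_one, ← fromBlocks_one, fromBlocks_smul, sub_eq_add_neg,
        fromBlocks_neg, fromBlocks_add, add_smul]
  let Y : Matrix (ι ⊕ ι) (ι ⊕ ι) ℂ := fromBlocks X⁻¹ (-(θ⁻¹ • (X⁻¹ * E))) (-(θ⁻¹ • (E * X⁻¹)))
    ((θ ^ 2)⁻¹ • (1 + E * X⁻¹ * E))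
  have hY : Y * (K θ - algebraMap ℝ _ s) = 1 := by
    have hθ2 : θ ^ 2 ≠ 0 := pow_ne_zero 2 hθ0
    have hEX : E * X⁻¹ * X = E := by rw [Matrix.mul_assoc, hXi, Matrix.mul_one]
    rw [hKs, fromBlocks_multiply, ← fromBlocks_one]
    congr 1
    · simp [Matrix.mul_add, hXi, smul_smul, hθ0, Matrix.mul_assoc]
    · have : θ ^ 2 * θ⁻¹ = θ := by field_simp
      simp [smul_smul, this]
    · have : θ * (θ ^ 2)⁻¹ = θ⁻¹ := by field_simp
      simp [Matrix.mul_add, Matrix.add_mul, hEX, smul_smul, this, Matrix.mul_assoc]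
    · simp [smul_smul, hθ0, hθ2]
  have hpd : (K θ - algebraMap ℝ _ s).PosDef := by
    have hps : (K θ - algebraMap ℝ _ s).PosSemidef := by
      have h1 := (hX.posSemidef.mul_mul_conjTranspose_same V).add
        (posSemidef_self_mul_conjTranspose (fromRows E (θ • 1)))
      convert h1 using 1
      rw [hKs, hVt]
      simp [V, fromRows_mul, conjTranspose_fromRows_eq_fromCols_conjTranspose, hE.eq]
      ext (i | i) (j | j) <;> simp [sq, mul_assoc]
    exact hps.posDef_iff_isUnit.mpr (IsUnit.of_mul_eq_one_right _ hY)
  have hKspec := spectrum_subset_Ioi_of_posDef hpd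
  have hg := cfc_inv_sub_eq (hK θ) s (fun h' => lt_irrefl s (hKspec h')) hY
  have hgA := cfc_inv_sub_eq hA s (fun h' => lt_irrefl s (hsA h')) hXi
  have hVY : Vᴴ * Y * V = X⁻¹ := by
    simp [hVt, V, Y, Matrix.mul_assoc, fromBlocks_mul_fromRows, fromCols_mul_fromRows]
  have hYspec : spectrum ℝ Y ⊆ Ioi (m - s)⁻¹ := by
    rw [← hg, cfc_map_spectrum (fun x => (x - s)⁻¹) (K θ) (hK θ).isSelfAdjoint
      (continuousOn_spectrum_of_isHermitian (hK θ) _)]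
    rintro _ ⟨x, hx, rfl⟩
    have h1 := hKspec hx
    have h2 := (hθs hx).2
    simp only [mem_Ioi] at h1 ⊢
    exact inv_strictAnti₀ (by linarith) (by linarith)
  have := h.jensen (hg ▸ isHermitian_cfc _ _) hYspec hV
  rw [hVY, ← hg, ← hgA, cfc_cfc_inv_sub (hK θ), cfc_cfc_inv_sub hA] at this
  exact this

lemma Set.Finite.exists_forall_lt_of_subset_isOpen {S U : Set ℝ} (hS : S.Finite) (hne : S.Nonempty)
    (hU : IsOpen U) (hSU : S ⊆ U) : ∃ y ∈ U, ∀ x ∈ S, y < x := by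
  obtain ⟨x, hx, hmin⟩ := hS.exists_minimalFor id S hne
  obtain ⟨y, hy, hyx⟩ := Filter.nonempty_of_mem (Filter.inter_mem
    (mem_nhdsWithin_of_mem_nhds (hU.mem_nhds (hSU hx))) (self_mem_nhdsWithin (s := Iio x)))
  exact ⟨y, hy, fun z hz => (mem_Iio.mp hyx).trans_le (le_of_not_gt fun h =>
    absurd (hmin hz h.le) (not_le.mpr h))⟩

lemma Set.Finite.exists_forall_gt_of_subset_isOpen {S U : Set ℝ} (hS : S.Finite) (hne : S.Nonempty)
    (hU : IsOpen U) (hSU : S ⊆ U) : ∃ y ∈ U, ∀ x ∈ S, x < y := by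
  obtain ⟨x, hx, hmax⟩ := hS.exists_maximalFor id S hne
  obtain ⟨y, hy, hyx⟩ := Filter.nonempty_of_mem (Filter.inter_mem
    (mem_nhdsWithin_of_mem_nhds (hU.mem_nhds (hSU hx))) (self_mem_nhdsWithin (s := Ioi x)))
  exact ⟨y, hy, fun z hz => (le_of_not_gt fun h =>
    absurd (hmax hz h.le) (not_le.mpr h) : z ≤ x).trans_lt (mem_Ioi.mp hyx)⟩

lemma tendsto_cfc_of_forall_spectrum {ι α : Type*} [Fintype ι] [DecidableEq ι] {l : Filter α}
    {F : α → ℝ → ℝ} {f : ℝ → ℝ} {A : Matrix ι ι ℂ} (hA : A.IsHermitian)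
    (h : ∀ x ∈ spectrum ℝ A, Filter.Tendsto (fun k => F k x) l (nhds (f x))) :
    Filter.Tendsto (fun k => cfc (F k) A) l (nhds (cfc f A)) := by
  simp only [hA.cfc_eq, IsHermitian.cfc, Unitary.conjStarAlgAut_apply]
  refine Filter.Tendsto.mul (Filter.Tendsto.mul tendsto_const_nhds ?_) tendsto_const_nhds
  refine (continuous_id.matrix_diagonal.tendsto _).comp (tendsto_pi_nhds.mpr fun i => ?_)
  exact (Complex.continuous_ofReal.tendsto _).comp
    (h _ (hA.eigenvalues_mem_spectrum_real i))

lemma posSemidef_cfc_indicator_sub {ι : Type*} [Fintype ι] [DecidableEq ι] {r : ℝ}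
    {A B : Matrix ι ι ℂ} (hA : A.IsHermitian) (hB : B.IsHermitian)
    (hsB : spectrum ℝ B ⊆ Iic r) (hAB : (B - A).PosSemidef) :
    (cfc (indicator {r} 1) B - cfc (indicator {r} 1) A).PosSemidef := by
  set f : ℝ → ℝ := indicator {r} 1 with hf
  have hff : ∀ x, f x * f x = f x := fun x => by by_cases hx : x = r <;> simp [hf, hx]
  have idem : ∀ {M : Matrix ι ι ℂ}, M.IsHermitian → cfc f M * cfc f M = cfc f M := by
    intro M hM
    rw [← cfc_mul f f M (continuousOn_spectrum_of_isHermitian hM _)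
      (continuousOn_spectrum_of_isHermitian hM _)]
    exact cfc_congr fun x _ => hff x
  set p := cfc f A with hp
  set q := cfc f B with hq
  have hpH : p.IsHermitian := isHermitian_cfc f A
  have hqH : q.IsHermitian := isHermitian_cfc f B
  have hAp : A * p = algebraMap ℝ _ r * p := by
    conv_lhs => rw [← cfc_id' ℝ A hA.isSelfAdjoint]
    rw [← cfc_const r A hA.isSelfAdjoint, hp, ← cfc_mul _ _ A (by fun_prop)
      (continuousOn_spectrum_of_isHermitian hA _), ← cfc_mul _ _ A (by fun_prop)
      (continuousOn_spectrum_of_isHermitian hA _)]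
    refine cfc_congr fun x _ => ?_
    by_cases hx : x = r <;> simp [hf, hx]
  have hrB : (algebraMap ℝ _ r - B).PosSemidef := by
    have hr : (algebraMap ℝ (Matrix ι ι ℂ) r).IsHermitian :=
      (cfc_predicate_algebraMap r : IsSelfAdjoint _)
    refine (hr.sub hB).posSemidef_iff_eigenvalues_nonneg.mpr ?_
    refine (spectrum_subset_iff_eigenvalues (hr.sub hB) (I := Ici 0)).mp ?_
    rw [← spectrum.singleton_sub_eq]
    rintro _ ⟨y, rfl, x, hx, rfl⟩
    exact mem_Ici.mpr (sub_nonneg.mpr (mem_Iic.mp (hsB hx)))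
  have hBp : (algebraMap ℝ _ r - B) * p = 0 := by
    obtain ⟨E, hE, hEE⟩ := exists_isHermitian_mul_self_eq hrB
    have h1 : (p * (algebraMap ℝ _ r - B) * p) = -(p * (B - A) * p) := by
      rw [← sub_eq_zero, sub_neg_eq_add, ← Matrix.add_mul, ← Matrix.mul_add, sub_add_sub_cancel,
        Matrix.mul_assoc, Matrix.sub_mul, hAp, sub_self, Matrix.mul_zero]
    have h2 := hrB.conjTranspose_mul_mul_same p
    have h3 := hAB.conjTranspose_mul_mul_same p
    rw [hpH.eq] at h2 h3
    have h4 : p * (algebraMap ℝ _ r - B) * p = 0 := by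
      open scoped MatrixOrder in
      exact le_antisymm (by rw [h1]; exact neg_nonpos.mpr h3.nonneg) h2.nonneg
    have h5 : (E * p)ᴴ * (E * p) = 0 := by
      rw [conjTranspose_mul, hpH.eq, hE.eq, Matrix.mul_assoc, ← Matrix.mul_assoc E, hEE,
        ← Matrix.mul_assoc, h4]
    rw [← hEE, Matrix.mul_assoc, conjTranspose_mul_self_eq_zero.mp h5, Matrix.mul_zero]
  have hqp : q * p = p := by
    have hr : (algebraMap ℝ (Matrix ι ι ℂ) r).IsHermitian :=
      (cfc_predicate_algebraMap r : IsSelfAdjoint _)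
    have := cfc_mul_eq_mul_cfc_of_intertwine hB hr (V := p) (by
      rw [← Algebra.commutes]
      rw [Matrix.sub_mul, sub_eq_zero] at hBp
      exact hBp.symm) f
    rwa [cfc_algebraMap, show f r = 1 by simp [hf], map_one, Matrix.mul_one] at this
  have hpq : p * q = p := by
    have := congrArg conjTranspose hqp
    rwa [conjTranspose_mul, hpH.eq, hqH.eq] at this
  have := posSemidef_conjTranspose_mul_self (q - p)
  rw [(hqH.sub hpH).eq] at this
  convert this using 1
  rw [Matrix.sub_mul, Matrix.mul_sub, Matrix.mul_sub, idem hA, idem hB, hqp, hpq]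
  abel

section

variable {I : Set ℝ} {φ : ℝ → ℝ}

/-- Composition with every operator convex function into `I` is strongly operator convex. -/
def ComposesStronglyOperatorConvex (φ : ℝ → ℝ) (I : Set ℝ) : Prop :=
  ∀ J : Set ℝ, Convex ℝ J → J.Nontrivial → ∀ f : ℝ → ℝ,
    OperatorConvexOn f J → f '' J ⊆ I → StronglyOperatorConvexOn (φ ∘ f) J

lemma ComposesStronglyOperatorConvex.stronglyOperatorConvexOn
    (h : ComposesStronglyOperatorConvex φ I) (hI : Convex ℝ I) (hnt : I.Nontrivial) :
    StronglyOperatorConvexOn φ I :=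
  h I hI hnt id (operatorConvexOn_id I) (by simp)

lemma ComposesStronglyOperatorConvex.posSemidef_of_interior
    (h : ComposesStronglyOperatorConvex φ I) (hI : Convex ℝ I) (hnt : I.Nontrivial)
    {ι : Type*} [Fintype ι] [DecidableEq ι] {A B : Matrix ι ι ℂ} (hA : A.IsHermitian)
    (hB : B.IsHermitian) (hsA : spectrum ℝ A ⊆ interior I) (hsB : spectrum ℝ B ⊆ interior I)
    (hAB : (B - A).PosSemidef) : (cfc φ B - cfc φ A).PosSemidef := by
  cases isEmpty_or_nonempty ι
  · rw [Subsingleton.elim (cfc φ B - cfc φ A) 0]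
    exact .zero
  have hfin : ∀ {M : Matrix ι ι ℂ}, M.IsHermitian → (spectrum ℝ M).Finite := fun hM => by
    rw [hM.spectrum_real_eq_range_eigenvalues]
    exact Set.finite_range _
  have hne : (spectrum ℝ A ∪ spectrum ℝ B).Nonempty := by
    rw [hA.spectrum_real_eq_range_eigenvalues]
    exact (Set.range_nonempty _).inl
  obtain ⟨s, hs, hs'⟩ := ((hfin hA).union (hfin hB)).exists_forall_lt_of_subset_isOpen hne
    isOpen_interior (union_subset hsA hsB)
  obtain ⟨s₀, hs₀, hs₀'⟩ := (Set.finite_singleton s).exists_forall_lt_of_subset_isOpen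
    (Set.singleton_nonempty s) isOpen_interior (Set.singleton_subset_iff.mpr hs)
  obtain ⟨m, hm, hm'⟩ := ((hfin hA).union (hfin hB)).exists_forall_gt_of_subset_isOpen hne
    isOpen_interior (union_subset hsA hsB)
  have hs₀s : s₀ < s := hs₀' s rfl
  have hsm : s < m := by
    obtain ⟨x, hx⟩ := hne
    exact (hs' x hx).trans (hm' x hx)
  refine posSemidef_cfc_sub_cfc_of_inv hs₀s hsm ?_ ?_ hA hB
    (fun x hx => mem_Ioi.mpr (hs' x (.inl hx)))
    (fun x hx => ⟨hs₀s.trans (hs' x (.inr hx)), hm' x (.inr hx)⟩) hAB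
  · refine ((h.stronglyOperatorConvexOn hI hnt).convexOn hI).continuousOn_interior.mono ?_
    exact Ioo_subset_Icc_self.trans (hI.interior.ordConnected.out hs₀ hm)
  · have hpos : 0 < (m - s)⁻¹ := inv_pos.mpr (sub_pos.mpr hsm)
    refine h _ (convex_Ioi _) (Set.Ioi_infinite _).nontrivial _ ?_ ?_
    · intro n hn t ht A B hA hB hAB hA' hB'
      exact operatorConvexOn_const_add_inv s n hn t ht A B hA hB hAB
        (fun i => hpos.trans (mem_Ioi.mp (hA' i))) (fun i => hpos.trans (mem_Ioi.mp (hB' i)))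
    · rintro _ ⟨x, hx, rfl⟩
      have hx := mem_Ioi.mp hx
      have hx0 := hpos.trans hx
      refine interior_subset (hI.interior.ordConnected.out hs hm ⟨?_, ?_⟩)
      · exact (lt_add_of_pos_right s (inv_pos.mpr hx0)).le
      · have := (inv_lt_comm₀ (sub_pos.mpr hsm) hx0).mp hx
        change s + x⁻¹ ≤ m
        linarith

lemma ComposesStronglyOperatorConvex.le_of_interior
    (h : ComposesStronglyOperatorConvex φ I) (hI : Convex ℝ I) (hnt : I.Nontrivial)
    {x y : ℝ} (hx : x ∈ interior I) (hy : y ∈ interior I) (hxy : x ≤ y) : φ x ≤ φ y := by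
  have hh : ∀ z : ℝ, (algebraMap ℝ (Matrix Unit Unit ℂ) z).IsHermitian := fun z =>
    (cfc_predicate_algebraMap z : IsSelfAdjoint _)
  have hp : ∀ {z : ℝ}, (algebraMap ℝ (Matrix Unit Unit ℂ) z).PosSemidef ↔ 0 ≤ z := by
    intro z
    rw [(hh z).posSemidef_iff_eigenvalues_nonneg]
    refine (spectrum_subset_iff_eigenvalues (hh z) (I := Ici 0)).symm.trans ?_
    simp
  have := h.posSemidef_of_interior hI hnt (hh x) (hh y) (by simpa using hx) (by simpa using hy)
    (by rw [← map_sub]; exact hp.mpr (sub_nonneg.mpr hxy))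
  rw [cfc_algebraMap, cfc_algebraMap, ← map_sub] at this
  exact sub_nonneg.mp (hp.mp this)

lemma ComposesStronglyOperatorConvex.le_of_interior_of_lt
    (h : ComposesStronglyOperatorConvex φ I) (hI : Convex ℝ I) (hnt : I.Nontrivial)
    {x r : ℝ} (hx : x ∈ interior I) (hr : r ∈ I) (hxr : x < r) : φ x ≤ φ r := by
  have hconv := (h.stronglyOperatorConvexOn hI hnt).convexOn hI
  have h1 := hI.combo_interior_self_mem_interior hx hr (a := 1 / 2) (b := 1 / 2)
    (by norm_num) (by norm_num) (by norm_num)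
  have h2 := hconv.2 (interior_subset hx) hr (by norm_num : (0 : ℝ) ≤ 1 / 2)
    (by norm_num : (0 : ℝ) ≤ 1 / 2) (by norm_num)
  have h3 := h.le_of_interior hI hnt hx h1 (by simp only [smul_eq_mul]; linarith)
  simp only [smul_eq_mul] at h2 h3
  linarith

lemma ComposesStronglyOperatorConvex.tendsto_add_sq
    (h : ComposesStronglyOperatorConvex φ I) (hI : Convex ℝ I)
    {x y : ℝ} (hx : x ∈ I) (hy : y ∈ I) (hxy : x < y) :
    Filter.Tendsto (fun t => φ (x + t ^ 2)) (nhds 0) (nhds (φ x)) := by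
  have ha : 0 < √(y - x) := Real.sqrt_pos.mpr (sub_pos.mpr hxy)
  have hJ : Convex ℝ (Icc (-√(y - x)) √(y - x)) := convex_Icc _ _
  have hsoc := h _ hJ ⟨-√(y - x), ⟨le_rfl, by linarith⟩, √(y - x), ⟨by linarith, le_rfl⟩,
    by linarith⟩ _ (operatorConvexOn_const_add_sq x _) (by
      rintro _ ⟨t, ht, rfl⟩
      refine hI.ordConnected.out hx hy ⟨by simp [sq_nonneg], ?_⟩
      have : t ^ 2 ≤ √(y - x) ^ 2 := sq_le_sq' ht.1 ht.2
      rw [Real.sq_sqrt (sub_pos.mpr hxy).le] at this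
      change x + t ^ 2 ≤ y
      linarith)
  have hc := (hsoc.convexOn hJ).continuousOn_interior.continuousAt (x := 0)
    (isOpen_interior.mem_nhds (by rw [interior_Icc]; exact ⟨by linarith, ha⟩))
  simpa [ContinuousAt, Function.comp_def] using hc

lemma ComposesStronglyOperatorConvex.tendsto_combo
    (h : ComposesStronglyOperatorConvex φ I) (hI : Convex ℝ I) (hnt : I.Nontrivial)
    {x c r : ℝ} (hx : x ∈ I) (hc : c ∈ I) (hr : r ∈ I) (hxr : x < r) :
    Filter.Tendsto (fun ε : ℝ => φ ((1 - ε) * x + ε * c)) (nhdsWithin 0 (Ioi 0))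
      (nhds (φ x)) := by
  rcases le_or_gt x c with hxc | hxc
  · have h1 : Filter.Tendsto (fun ε : ℝ => √(ε * (c - x))) (nhdsWithin 0 (Ioi 0)) (nhds 0) := by
      refine (Continuous.tendsto' (by fun_prop) _ _ (by simp)).mono_left nhdsWithin_le_nhds
    refine ((h.tendsto_add_sq hI hx hr hxr).comp h1).congr' ?_
    filter_upwards [self_mem_nhdsWithin] with ε hε
    have : 0 ≤ ε * (c - x) := mul_nonneg (mem_Ioi.mp hε).le (sub_nonneg.mpr hxc)
    simp only [Function.comp_apply, Real.sq_sqrt this]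
    congr 1
    ring
  · have hxi : x ∈ interior I := mem_interior.mpr ⟨Ioo c r,
      Ioo_subset_Icc_self.trans (hI.ordConnected.out hc hr), isOpen_Ioo, hxc, hxr⟩
    have hcont := ((h.stronglyOperatorConvexOn hI hnt).convexOn hI).continuousOn_interior.continuousAt
      (isOpen_interior.mem_nhds hxi)
    have h1 : Filter.Tendsto (fun ε : ℝ => (1 - ε) * x + ε * c) (nhdsWithin 0 (Ioi 0)) (nhds x) :=
      (Continuous.tendsto' (by fun_prop) _ _ (by simp)).mono_left nhdsWithin_le_nhds
    exact hcont.tendsto.comp h1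

lemma ComposesStronglyOperatorConvex.posSemidef_combo
    (h : ComposesStronglyOperatorConvex φ I) (hI : Convex ℝ I) (hnt : I.Nontrivial)
    {ι : Type*} [Fintype ι] [DecidableEq ι] {A B : Matrix ι ι ℂ} (hA : A.IsHermitian)
    (hB : B.IsHermitian) (hsA : spectrum ℝ A ⊆ I) (hsB : spectrum ℝ B ⊆ I)
    (hAB : (B - A).PosSemidef) {c ε : ℝ} (hc : c ∈ interior I) (hε : 0 < ε) (hε1 : ε ≤ 1) :
    (cfc (fun x => φ ((1 - ε) * x + ε * c)) B -
      cfc (fun x => φ ((1 - ε) * x + ε * c)) A).PosSemidef := by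
  have comp : ∀ {M : Matrix ι ι ℂ}, M.IsHermitian → cfc (fun x => φ ((1 - ε) * x + ε * c)) M =
      cfc φ (cfc (fun x => (1 - ε) * x + ε * c) M) := by
    intro M hM
    have hfin := Set.finite_range hM.eigenvalues
    rw [← hM.spectrum_real_eq_range_eigenvalues] at hfin
    exact cfc_comp' φ (fun x => (1 - ε) * x + ε * c) M ((hfin.image _).continuousOn _)
      (hfin.continuousOn _) hM.isSelfAdjoint
  have spec : ∀ {M : Matrix ι ι ℂ}, M.IsHermitian → spectrum ℝ M ⊆ I →
      spectrum ℝ (cfc (fun x => (1 - ε) * x + ε * c) M) ⊆ interior I := by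
    intro M hM hs
    rw [cfc_map_spectrum (fun x => (1 - ε) * x + ε * c) M hM.isSelfAdjoint
      (continuousOn_spectrum_of_isHermitian hM _)]
    rintro _ ⟨x, hx, rfl⟩
    exact hI.combo_self_interior_mem_interior (hs hx) hc (by linarith) hε (by ring)
  have lin : ∀ {M : Matrix ι ι ℂ}, M.IsHermitian →
      cfc (fun x => (1 - ε) * x + ε * c) M = (1 - ε) • M + algebraMap ℝ _ (ε * c) := by
    intro M hM
    rw [cfc_add_const (ε * c) (fun x => (1 - ε) * x) M (by fun_prop) hM.isSelfAdjoint,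
      cfc_const_mul_id (1 - ε) M hM.isSelfAdjoint]
  rw [comp hA, comp hB]
  refine h.posSemidef_of_interior hI hnt (isHermitian_cfc _ _) (isHermitian_cfc _ _)
    (spec hA hsA) (spec hB hsB) ?_
  rw [lin hA, lin hB, add_sub_add_right_eq_sub, ← smul_sub]
  exact hAB.smul (sub_nonneg.mpr hε1)

lemma ComposesStronglyOperatorConvex.operatorMonotoneOn
    (h : ComposesStronglyOperatorConvex φ I) (hI : Convex ℝ I) (hnt : I.Nontrivial) :
    OperatorMonotoneOn φ I := by
  intro n _ A B hA hB hsA hsB hAB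
  rw [← spectrum_subset_iff_eigenvalues] at hsA hsB
  rw [← hA.cfc_eq, ← hB.cfc_eq]
  have hint : (interior I).Nonempty := by
    obtain ⟨x, hx, y, hy, hxy⟩ := hnt.exists_lt
    obtain ⟨z, hz⟩ := nonempty_Ioo.mpr hxy
    exact ⟨z, mem_interior.mpr ⟨_, Ioo_subset_Icc_self.trans (hI.ordConnected.out hx hy),
      isOpen_Ioo, hz⟩⟩
  obtain ⟨d, hd⟩ := hint
  obtain ⟨c, hc, hcd⟩ := (Set.finite_singleton d).exists_forall_lt_of_subset_isOpen
    (Set.singleton_nonempty d) isOpen_interior (Set.singleton_subset_iff.mpr hd)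
  have hfin : ∀ {M : Matrix (Fin n) (Fin n) ℂ}, M.IsHermitian → (spectrum ℝ M).Finite :=
    fun hM => by
      rw [hM.spectrum_real_eq_range_eigenvalues]
      exact Set.finite_range _
  obtain ⟨r, hrS, hr⟩ := (((hfin hA).union (hfin hB)).insert d).exists_maximalFor id _
    (Set.insert_nonempty _ _)
  have hrI : r ∈ I := insert_subset (interior_subset hd) (union_subset hsA hsB) hrS
  have hle : ∀ x ∈ insert d (spectrum ℝ A ∪ spectrum ℝ B), x ≤ r := fun x hx =>
    le_of_not_gt fun hlt => absurd (hr hx hlt.le) (not_le.mpr hlt)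
  have hcr : c < r := (hcd d rfl).trans_le (hle d (mem_insert _ _))
  let g : ℝ → ℝ → ℝ := fun ε x => φ ((1 - ε) * x + ε * c)
  have hlim : ∀ {M : Matrix (Fin n) (Fin n) ℂ}, M.IsHermitian → spectrum ℝ M ⊆ I →
      spectrum ℝ M ⊆ Iic r → Filter.Tendsto (fun ε => cfc (fun x => g ε x +
        (φ r - g ε r) * indicator {r} 1 x) M) (nhdsWithin 0 (Ioi 0)) (nhds (cfc φ M)) := by
    intro M hM hs hsr
    refine tendsto_cfc_of_forall_spectrum hM fun x hx => ?_
    rcases eq_or_lt_of_le (mem_Iic.mp (hsr hx)) with rfl | hxr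
    · simp
    · simpa [hxr.ne] using h.tendsto_combo hI hnt (hs hx) (interior_subset hc) hrI hxr
  refine posSemidef_of_tendsto ((hlim hB hsB fun x hx => mem_Iic.mpr (hle x (.inr (.inr hx)))).sub
    (hlim hA hsA fun x hx => mem_Iic.mpr (hle x (.inr (.inl hx))))) ?_
  filter_upwards [Ioo_mem_nhdsGT (zero_lt_one (α := ℝ))] with ε hε
  have hsum : ∀ {M : Matrix (Fin n) (Fin n) ℂ}, M.IsHermitian →
      cfc (fun x => g ε x + (φ r - g ε r) * indicator {r} 1 x) M =
        cfc (g ε) M + (φ r - g ε r) • cfc (indicator {r} 1) M := by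
    intro M hM
    rw [cfc_add M (g ε) _ (continuousOn_spectrum_of_isHermitian hM _)
      (continuousOn_spectrum_of_isHermitian hM _), cfc_const_mul _ _ M
      (continuousOn_spectrum_of_isHermitian hM _)]
  have hnonneg : 0 ≤ φ r - g ε r := by
    refine sub_nonneg.mpr (h.le_of_interior_of_lt hI hnt ?_ hrI ?_)
    · exact hI.combo_self_interior_mem_interior hrI hc (sub_nonneg.mpr hε.2.le) hε.1 (by ring)
    · nlinarith [hε.1]
  rw [hsum hA, hsum hB, add_sub_add_comm, ← smul_sub]
  exact (h.posSemidef_combo hI hnt hA hB hsA hsB hAB hc hε.1 hε.2.le).add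
    ((posSemidef_cfc_indicator_sub hA hB
      (fun x hx => mem_Iic.mpr (hle x (.inr (.inr hx)))) hAB).smul hnonneg)

end

/-- if `φ∘f` is strongly operator convex on `J` for every nondegenerate interval
`J` and every operator convex `f` on `J` with `f(J) ⊆ I`, then `φ` is operator monotone and
strongly operator convex on `I`. -/
theorem stmt11 (I : Set ℝ) (hI : Convex ℝ I) (hnt : I.Nontrivial) (φ : ℝ → ℝ)
    (h : ∀ (J : Set ℝ), Convex ℝ J → J.Nontrivial → ∀ f : ℝ → ℝ,
      OperatorConvexOn f J → f '' J ⊆ I → StronglyOperatorConvexOn (φ ∘ f) J) :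
    OperatorMonotoneOn φ I ∧ StronglyOperatorConvexOn φ I := by
  exact ⟨ComposesStronglyOperatorConvex.operatorMonotoneOn h hI hnt,
    ComposesStronglyOperatorConvex.stronglyOperatorConvexOn h hI hnt⟩
end

section
/- For every α with 0 < α < 1, the function f : (0,∞) → ℝ defined by f(x) = (x^(α−1) − 1)/(x − 1) for x ≠ 1 and f(1) = α − 1 is operator monotone on (0,∞). -/
open Matrix Set
open scoped ComplexOrder

open MeasureTheory Filter Topology

/-- The squared moduli of the coordinates of `v` in the eigenbasis of a Hermitian matrix. -/
noncomputable def Matrix.IsHermitian.eigenWeight {n : ℕ} {A : Matrix (Fin n) (Fin n) ℂ}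
    (hA : A.IsHermitian) (v : Fin n → ℂ) (i : Fin n) : ℝ :=
  Complex.normSq ((star (hA.eigenvectorUnitary : Matrix (Fin n) (Fin n) ℂ) *ᵥ v) i)

lemma Matrix.IsHermitian.dotProduct_cfc_mulVec {n : ℕ} {A : Matrix (Fin n) (Fin n) ℂ}
    (hA : A.IsHermitian) (f : ℝ → ℝ) (v : Fin n → ℂ) :
    star v ⬝ᵥ (hA.cfc f *ᵥ v) =
      ((∑ i, hA.eigenWeight v i * f (hA.eigenvalues i) : ℝ) : ℂ) := by
  rw [Matrix.IsHermitian.cfc, Unitary.conjStarAlgAut_apply, ← mulVec_mulVec, ← mulVec_mulVec,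
    dotProduct_mulVec]
  have h : star v ᵥ* (hA.eigenvectorUnitary : Matrix (Fin n) (Fin n) ℂ) =
      star (star (hA.eigenvectorUnitary : Matrix (Fin n) (Fin n) ℂ) *ᵥ v) := by
    rw [star_mulVec, star_eq_conjTranspose, conjTranspose_conjTranspose]
  rw [h]
  simp only [dotProduct, mulVec_diagonal, Pi.star_apply, eigenWeight, Complex.ofReal_sum,
    Complex.ofReal_mul, Complex.normSq_eq_conj_mul_self, Function.comp_apply]
  refine Finset.sum_congr rfl fun i _ => ?_
  simp only [RCLike.star_def, Complex.coe_algebraMap]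
  ring

lemma Matrix.IsHermitian.isHermitian_cfc {n : ℕ} {A : Matrix (Fin n) (Fin n) ℂ}
    (hA : A.IsHermitian) (f : ℝ → ℝ) : (hA.cfc f).IsHermitian := by
  rw [← hA.cfc_eq]
  exact cfc_predicate f A

lemma Matrix.IsHermitian.posSemidef_cfc_sub_cfc_iff {n : ℕ} {A B : Matrix (Fin n) (Fin n) ℂ}
    (hA : A.IsHermitian) (hB : B.IsHermitian) (f : ℝ → ℝ) :
    (hB.cfc f - hA.cfc f).PosSemidef ↔
      ∀ v, ∑ i, hA.eigenWeight v i * f (hA.eigenvalues i) ≤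
        ∑ i, hB.eigenWeight v i * f (hB.eigenvalues i) := by
  simp only [posSemidef_iff_dotProduct_mulVec, (hB.isHermitian_cfc f).sub (hA.isHermitian_cfc f),
    true_and, sub_mulVec, dotProduct_sub, dotProduct_cfc_mulVec, sub_nonneg, Complex.real_le_real]

lemma Matrix.IsHermitian.sum_eigenWeight {n : ℕ} {A : Matrix (Fin n) (Fin n) ℂ}
    (hA : A.IsHermitian) (v : Fin n → ℂ) :
    ((∑ i, hA.eigenWeight v i : ℝ) : ℂ) = star v ⬝ᵥ v := by
  have h := hA.dotProduct_cfc_mulVec (fun _ => 1) v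
  have h_one : cfc (fun _ => 1 : ℝ → ℝ) A = 1 := cfc_const_one ℝ A hA
  rw [← hA.cfc_eq, h_one, one_mulVec] at h
  simpa using h.symm

section LoewnerOrder

open scoped MatrixOrder Matrix.Norms.L2Operator

/-- The integrand representing `x ↦ x ^ p` is operator monotone on `(0,∞)`. -/
lemma operatorMonotoneOn_rpowIntegrand₀₁ {p t : ℝ} (hp : p ∈ Ioo (0 : ℝ) 1) (ht : 0 < t) :
    OperatorMonotoneOn (Real.rpowIntegrand₀₁ p t) (Ioi 0) := by
  intro n _ A B hA hB hA0 hB0 hAB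
  have hA' : 0 ≤ A := (hA.posSemidef_iff_eigenvalues_nonneg.2 fun i => (hA0 i).le).nonneg
  have hB' : 0 ≤ B := (hB.posSemidef_iff_eigenvalues_nonneg.2 fun i => (hB0 i).le).nonneg
  have h := CFC.monotoneOn_cfcₙ_rpowIntegrand₀₁ hp ht hA' hB' (Matrix.le_iff.2 hAB)
  have hcfc (C : Matrix (Fin n) (Fin n) ℂ) (hC : C.IsHermitian) :
      cfcₙ (Real.rpowIntegrand₀₁ p t) C = hC.cfc (Real.rpowIntegrand₀₁ p t) := by
    have hfin : (quasispectrum ℝ C).Finite := by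
      rw [quasispectrum_eq_spectrum_union_zero]
      exact Matrix.finite_real_spectrum.union (Set.finite_singleton 0)
    rw [cfcₙ_eq_cfc (hfin.continuousOn _) Real.rpowIntegrand₀₁_zero_right, hC.cfc_eq]
  simp only [hcfc A hA, hcfc B hB] at h
  exact Matrix.le_iff.1 h

end LoewnerOrder

/-- The integrand representing the difference quotient of `x ↦ x ^ (p - 1)` at `s`. -/
noncomputable def slopeIntegrand (p s t x : ℝ) : ℝ :=
  (t * (t + s))⁻¹ * (Real.rpowIntegrand₀₁ p t x - t ^ (p - 1))

lemma slopeIntegrand_eq {p s t x : ℝ} (hp : p ∈ Ioo (0 : ℝ) 1) (hs : 0 < s) (ht : 0 < t)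
    (hx : 0 < x) (hxs : x ≠ s) :
    slopeIntegrand p s t x =
      (Real.rpowIntegrand₀₁ p t x / x - Real.rpowIntegrand₀₁ p t s / s) / (x - s) := by
  have h : x - s ≠ 0 := sub_ne_zero.2 hxs
  rw [slopeIntegrand, Real.rpowIntegrand₀₁_eq_pow_div hp ht.le hx.le,
    Real.rpowIntegrand₀₁_eq_pow_div hp ht.le hs.le]
  field_simp
  ring

lemma integrableOn_slopeIntegrand {p s x : ℝ} (hp : p ∈ Ioo (0 : ℝ) 1) (hs : 0 < s)
    (hx : 0 < x) (hxs : x ≠ s) : IntegrableOn (fun t => slopeIntegrand p s t x) (Ioi 0) := by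
  refine IntegrableOn.congr_fun ?_
    (fun t ht => (slopeIntegrand_eq hp hs ht hx hxs).symm) measurableSet_Ioi
  exact (((Real.integrableOn_rpowIntegrand₀₁_Ioi hp hx.le).div_const x).sub
    ((Real.integrableOn_rpowIntegrand₀₁_Ioi hp hs.le).div_const s)).div_const _

lemma slope_rpow_eq_const_mul_integral {p s x : ℝ} (hp : p ∈ Ioo (0 : ℝ) 1) (hs : 0 < s)
    (hx : 0 < x) (hxs : x ≠ s) :
    (x ^ (p - 1) - s ^ (p - 1)) / (x - s) =
      (∫ t in Ioi 0, Real.rpowIntegrand₀₁ p t 1)⁻¹ * ∫ t in Ioi 0, slopeIntegrand p s t x := by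
  rw [setIntegral_congr_fun measurableSet_Ioi
    fun t ht => slopeIntegrand_eq hp hs ht hx hxs, integral_div,
    integral_sub ((Real.integrableOn_rpowIntegrand₀₁_Ioi hp hx.le).div_const x)
      ((Real.integrableOn_rpowIntegrand₀₁_Ioi hp hs.le).div_const s), integral_div, integral_div,
    Real.integral_rpowIntegrand₀₁_eq_rpow_mul_const hp hx.le,
    Real.integral_rpowIntegrand₀₁_eq_rpow_mul_const hp hs.le,
    Real.rpow_sub_one hx.ne', Real.rpow_sub_one hs.ne']
  have := (Real.integral_rpowIntegrand₀₁_one_pos hp).ne'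
  field_simp

lemma operatorMonotoneOn_slopeIntegrand {p s t : ℝ} (hp : p ∈ Ioo (0 : ℝ) 1) (hs : 0 < s)
    (ht : 0 < t) : OperatorMonotoneOn (slopeIntegrand p s t) (Ioi 0) := by
  intro n hn A B hA hB hA0 hB0 hAB
  have h := operatorMonotoneOn_rpowIntegrand₀₁ hp ht n hn A B hA hB hA0 hB0 hAB
  rw [hA.posSemidef_cfc_sub_cfc_iff hB] at h ⊢
  intro v
  have hsum (C : Matrix (Fin n) (Fin n) ℂ) (hC : C.IsHermitian) :
      ∑ i, hC.eigenWeight v i * slopeIntegrand p s t (hC.eigenvalues i) =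
        (t * (t + s))⁻¹ * (∑ i, hC.eigenWeight v i *
          Real.rpowIntegrand₀₁ p t (hC.eigenvalues i) -
            (∑ i, hC.eigenWeight v i) * t ^ (p - 1)) := by
    rw [Finset.sum_mul, ← Finset.sum_sub_distrib, Finset.mul_sum]
    refine Finset.sum_congr rfl fun i _ => ?_
    rw [slopeIntegrand]
    ring
  have hw : ∑ i, hA.eigenWeight v i = ∑ i, hB.eigenWeight v i :=
    Complex.ofReal_injective ((hA.sum_eigenWeight v).trans (hB.sum_eigenWeight v).symm)
  rw [hsum A hA, hsum B hB, hw]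
  exact mul_le_mul_of_nonneg_left (sub_le_sub_right (h v) _) (by positivity)

/-- The difference quotient of `x ↦ x ^ (p - 1)` at `s` satisfies the operator monotonicity
inequality for matrices whose spectra avoid `s`. -/
lemma posSemidef_cfc_slope_sub_cfc_slope {p s : ℝ} (hp : p ∈ Ioo (0 : ℝ) 1) (hs : 0 < s) {n : ℕ}
    (hn : 0 < n) {A B : Matrix (Fin n) (Fin n) ℂ} (hA : A.IsHermitian) (hB : B.IsHermitian)
    (hA0 : ∀ i, hA.eigenvalues i ∈ Ioi 0) (hB0 : ∀ i, hB.eigenvalues i ∈ Ioi 0)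
    (hAs : ∀ i, hA.eigenvalues i ≠ s) (hBs : ∀ i, hB.eigenvalues i ≠ s)
    (hAB : (B - A).PosSemidef) :
    (hB.cfc (fun x => (x ^ (p - 1) - s ^ (p - 1)) / (x - s)) -
      hA.cfc (fun x => (x ^ (p - 1) - s ^ (p - 1)) / (x - s))).PosSemidef := by
  rw [hA.posSemidef_cfc_sub_cfc_iff hB]
  intro v
  have hint (C : Matrix (Fin n) (Fin n) ℂ) (hC : C.IsHermitian)
      (hC0 : ∀ i, hC.eigenvalues i ∈ Ioi 0) (hCs : ∀ i, hC.eigenvalues i ≠ s) (i : Fin n) :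
      IntegrableOn (fun t => hC.eigenWeight v i * slopeIntegrand p s t (hC.eigenvalues i))
        (Ioi 0) :=
    (integrableOn_slopeIntegrand hp hs (hC0 i) (hCs i)).const_mul _
  have hsum (C : Matrix (Fin n) (Fin n) ℂ) (hC : C.IsHermitian)
      (hC0 : ∀ i, hC.eigenvalues i ∈ Ioi 0) (hCs : ∀ i, hC.eigenvalues i ≠ s) :
      ∑ i, hC.eigenWeight v i *
          ((hC.eigenvalues i ^ (p - 1) - s ^ (p - 1)) / (hC.eigenvalues i - s)) =
        (∫ t in Ioi 0, Real.rpowIntegrand₀₁ p t 1)⁻¹ *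
          ∫ t in Ioi 0, ∑ i, hC.eigenWeight v i * slopeIntegrand p s t (hC.eigenvalues i) := by
    rw [integral_finsetSum _ fun i _ => hint C hC hC0 hCs i, Finset.mul_sum]
    refine Finset.sum_congr rfl fun i _ => ?_
    rw [slope_rpow_eq_const_mul_integral hp hs (hC0 i) (hCs i), integral_const_mul]
    ring
  rw [hsum A hA hA0 hAs, hsum B hB hB0 hBs]
  refine mul_le_mul_of_nonneg_left ?_ (inv_nonneg.2 (Real.integral_rpowIntegrand₀₁_one_pos hp).le)
  refine setIntegral_mono_on (integrable_finsetSum _ fun i _ => hint A hA hA0 hAs i)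
    (integrable_finsetSum _ fun i _ => hint B hB hB0 hBs i) measurableSet_Ioi fun t ht => ?_
  exact (hA.posSemidef_cfc_sub_cfc_iff hB _).1
    (operatorMonotoneOn_slopeIntegrand hp hs ht n hn A B hA hB hA0 hB0 hAB) v

lemma tendsto_slope_rpow (p : ℝ) (x : ℝ) :
    Tendsto (fun s : ℝ => (x ^ (p - 1) - s ^ (p - 1)) / (x - s)) (𝓝[≠] 1)
      (𝓝 (if x = 1 then p - 1 else (x ^ (p - 1) - 1) / (x - 1))) := by
  split_ifs with hx
  · have h : HasDerivAt (fun s : ℝ => s ^ (p - 1)) (p - 1) 1 := by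
      simpa using Real.hasDerivAt_rpow_const (x := 1) (p := p - 1) (.inl one_ne_zero)
    refine (hasDerivAt_iff_tendsto_slope.1 h).congr fun s => ?_
    rw [hx, slope_comm, slope_def_field]
  · have h : ContinuousAt (fun s : ℝ => (x ^ (p - 1) - s ^ (p - 1)) / (x - s)) 1 := by
      refine ContinuousAt.div ?_ (by fun_prop) (sub_ne_zero.2 hx)
      exact continuousAt_const.sub (Real.continuousAt_rpow_const 1 (p - 1) (.inl one_ne_zero))
    simpa using h.tendsto.mono_left nhdsWithin_le_nhds

lemma eventually_punctured_nhds_forall_ne {n : ℕ} (l : Fin n → ℝ) (a : ℝ) :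
    ∀ᶠ s in 𝓝[≠] a, ∀ i, l i ≠ s := by
  refine eventually_all.2 fun i => ?_
  rcases eq_or_ne (l i) a with h | h
  · filter_upwards [self_mem_nhdsWithin] with s hs
    exact fun h' => hs (h'.symm.trans h)
  · exact (eventually_ne_nhds h.symm).filter_mono nhdsWithin_le_nhds |>.mono fun _ h => h.symm

/-- for `0 < α < 1`, the function `x ↦ (x^(α−1) − 1)/(x − 1)` (with value
`α − 1` at `x = 1`) is operator monotone on `(0,∞)`. -/
theorem stmt13 (α : ℝ) (hα0 : 0 < α) (hα1 : α < 1) :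
    OperatorMonotoneOn
      (fun x => if x = 1 then α - 1 else (x ^ (α - 1) - 1) / (x - 1))
      (Set.Ioi (0 : ℝ)) := by
  intro n hn A B hA hB hA0 hB0 hAB
  rw [hA.posSemidef_cfc_sub_cfc_iff hB]
  intro v
  have htend (C : Matrix (Fin n) (Fin n) ℂ) (hC : C.IsHermitian) :=
    tendsto_finsetSum Finset.univ fun i _ =>
      (tendsto_slope_rpow α (hC.eigenvalues i)).const_mul (hC.eigenWeight v i)
  refine le_of_tendsto_of_tendsto (htend A hA) (htend B hB) ?_
  filter_upwards [eventually_punctured_nhds_forall_ne hA.eigenvalues 1,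
    eventually_punctured_nhds_forall_ne hB.eigenvalues 1,
    nhdsWithin_le_nhds (lt_mem_nhds (zero_lt_one' ℝ))] with s hAs hBs hs
  exact (hA.posSemidef_cfc_sub_cfc_iff hB _).1
    (posSemidef_cfc_slope_sub_cfc_slope ⟨hα0, hα1⟩ hs hn hA hB hA0 hB0 hAs hBs hAB) v
end
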